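/- (Direct-part equivocation bound.) Let (X_1, W_1), …, (X_n, W_n) be i.i.d. pairs on finite alphabets, let B = φ(X^n) be a binary string that is a deterministic function of X^n, let K be uniformly distributed on {0,1}^m and independent of (X^n, W^n), and let Z be obtained from B by XORing its first m bits with K (leaving the remaining bits unchanged). Then H(X^n | W^n, Z) ≥ n·H(X|W) − H(Z) + H(K), where H(K) = m. -/

import Mathlib

open scoped BigOperators Classical

noncomputable section

/-- Probability of the event `E` on a finite probability space with mass function `p`. -/
def pr {Ω : Type*} [Fintype Ω] (p : Ω → ℝ) (E : Ω → Prop) : ℝ :=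
  ∑ ω : Ω, if E ω then p ω else 0

/-- Shannon entropy (in bits) of the random variable `F` on the finite probability space
`(Ω, p)`. -/
def ent {Ω : Type*} [Fintype Ω] (p : Ω → ℝ) {β : Type*} (F : Ω → β) : ℝ :=
  ∑ ω : Ω, -(p ω * Real.logb 2 (pr p (fun ω' => F ω' = F ω)))

/-- Conditional Shannon entropy (in bits) `H(F|G) = H(F,G) − H(G)`. -/
def condEnt {Ω : Type*} [Fintype Ω] (p : Ω → ℝ) {β γ : Type*} (F : Ω → β) (G : Ω → γ) : ℝ :=
  ent p (fun ω => (F ω, G ω)) - ent p G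

/-- XOR the first `m` bits of the binary string `b` with the key `k`, leaving the
remaining bits unchanged. -/
def encrypt (m : ℕ) (b : List Bool) (k : Fin m → Bool) : List Bool :=
  (List.range b.length).map fun j =>
    if h : j < m then Bool.xor (b.getD j false) (k ⟨j, h⟩) else b.getD j false

lemma pr_nonneg' {Ω : Type*} [Fintype Ω] (p : Ω → ℝ) (hp : ∀ ω, 0 ≤ p ω) (E : Ω → Prop) :
    0 ≤ pr p E := by
  unfold pr
  refine Finset.sum_nonneg fun ω _ => ?_
  split_ifs
  · exact hp ω
  · exact le_rfl

lemma le_pr_self {Ω : Type*} [Fintype Ω] (p : Ω → ℝ) (hp : ∀ ω, 0 ≤ p ω) (E : Ω → Prop)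
    (ω : Ω) (h : E ω) : p ω ≤ pr p E := by
  unfold pr
  have := Finset.single_le_sum (f := fun ω => if E ω then p ω else 0) (s := Finset.univ)
    (fun i _ => by
      show 0 ≤ (if E i then p i else 0)
      split_ifs
      · exact hp i
      · exact le_rfl) (Finset.mem_univ ω)
  simpa [h] using this

lemma ent_injective {Ω β : Type*} [Fintype Ω] (p : Ω → ℝ) (F : Ω → β)
    (hF : Function.Injective F) : ent p F = ∑ ω, -(p ω * Real.logb 2 (p ω)) := by
  unfold ent pr
  refine Finset.sum_congr rfl fun ω _ => ?_
  simp [hF.eq_iff]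

lemma subadd_aux {Ω β γ : Type*} [Fintype Ω] (p : Ω → ℝ) (hp : ∀ ω, 0 ≤ p ω)
    (h1 : ∑ ω, p ω = 1) (F : Ω → β) (G : Ω → γ) :
    ∑ ω, p ω * (pr p (fun ω' => F ω' = F ω) * pr p (fun ω' => G ω' = G ω) /
      pr p (fun ω' => (F ω', G ω') = (F ω, G ω))) ≤ 1 := by
  have key : ∀ a b, ∑ ω, (if F a = F ω ∧ G b = G ω then
      p ω / pr p (fun ω' => (F ω', G ω') = (F ω, G ω)) else 0) ≤ 1 := by
    intro a b
    have : ∑ ω, (if F a = F ω ∧ G b = G ω then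
      p ω / pr p (fun ω' => (F ω', G ω') = (F ω, G ω)) else 0)
      = pr p (fun ω' => (F ω', G ω') = (F a, G b)) / pr p (fun ω' => (F ω', G ω') = (F a, G b)) := by
      conv_rhs => rw [pr, Finset.sum_div]
      refine Finset.sum_congr rfl fun ω _ => ?_
      by_cases h : F a = F ω ∧ G b = G ω
      · simp [h, pr]
      · have h' : ¬ (F ω = F a ∧ G ω = G b) := fun hh => h ⟨hh.1.symm, hh.2.symm⟩
        simp [h, h']
    rw [this]
    exact div_self_le_one _
  calc _ = ∑ ω, ∑ a, ∑ b, p a * p b * (if F a = F ω ∧ G b = G ω then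
      p ω / pr p (fun ω' => (F ω', G ω') = (F ω, G ω)) else 0) := by
        refine Finset.sum_congr rfl fun ω _ => ?_
        generalize pr p (fun ω' => (F ω', G ω') = (F ω, G ω)) = c
        unfold pr
        rw [Finset.sum_mul_sum, Finset.sum_div, Finset.mul_sum]
        refine Finset.sum_congr rfl fun a _ => ?_
        rw [Finset.sum_div, Finset.mul_sum]
        refine Finset.sum_congr rfl fun b _ => ?_
        by_cases ha : F a = F ω <;> by_cases hb : G b = G ω <;> simp [ha, hb]
        ring
    _ = ∑ a, ∑ b, p a * p b * ∑ ω, (if F a = F ω ∧ G b = G ω then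
      p ω / pr p (fun ω' => (F ω', G ω') = (F ω, G ω)) else 0) := by
        rw [Finset.sum_comm]
        refine Finset.sum_congr rfl fun a _ => ?_
        rw [Finset.sum_comm]
        refine Finset.sum_congr rfl fun b _ => ?_
        rw [Finset.mul_sum]
    _ ≤ ∑ a, ∑ b, p a * p b := by
        refine Finset.sum_le_sum fun a _ => Finset.sum_le_sum fun b _ => ?_
        exact mul_le_of_le_one_right (mul_nonneg (hp a) (hp b)) (key a b)
    _ = 1 := by rw [← Finset.sum_mul_sum, h1, one_mul]

lemma ent_subadd {Ω β γ : Type*} [Fintype Ω] (p : Ω → ℝ) (hp : ∀ ω, 0 ≤ p ω)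
    (h1 : ∑ ω, p ω = 1) (F : Ω → β) (G : Ω → γ) :
    ent p (fun ω => (F ω, G ω)) ≤ ent p F + ent p G := by
  have hl : 0 < Real.log 2 := Real.log_pos (by norm_num)
  have aux := subadd_aux p hp h1 F G
  have pt : ∀ ω, p ω * (Real.log (pr p (fun ω' => F ω' = F ω)) +
      Real.log (pr p (fun ω' => G ω' = G ω)) -
      Real.log (pr p (fun ω' => (F ω', G ω') = (F ω, G ω)))) ≤
      p ω * (pr p (fun ω' => F ω' = F ω) * pr p (fun ω' => G ω' = G ω) /
      pr p (fun ω' => (F ω', G ω') = (F ω, G ω))) - p ω := by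
    intro ω
    rcases (hp ω).eq_or_lt with h0 | h0
    · simp [← h0]
    have hA := h0.trans_le (le_pr_self p hp (fun ω' => F ω' = F ω) ω rfl)
    have hB := h0.trans_le (le_pr_self p hp (fun ω' => G ω' = G ω) ω rfl)
    have hC := h0.trans_le (le_pr_self p hp (fun ω' => (F ω', G ω') = (F ω, G ω)) ω rfl)
    rw [← Real.log_mul hA.ne' hB.ne', ← Real.log_div (mul_pos hA hB).ne' hC.ne']
    have := Real.log_le_sub_one_of_pos (div_pos (mul_pos hA hB) hC)
    have := mul_le_mul_of_nonneg_left this h0.le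
    linarith
  have hs := Finset.sum_le_sum fun ω (_ : ω ∈ Finset.univ) => pt ω
  rw [Finset.sum_sub_distrib, h1] at hs
  have hs' := div_nonpos_of_nonpos_of_nonneg (hs.trans (by linarith)) hl.le
  have : ent p (fun ω => (F ω, G ω)) - (ent p F + ent p G) =
    (∑ ω, p ω * (Real.log (pr p (fun ω' => F ω' = F ω)) +
      Real.log (pr p (fun ω' => G ω' = G ω)) -
      Real.log (pr p (fun ω' => (F ω', G ω') = (F ω, G ω))))) / Real.log 2 := by
    unfold ent Real.logb
    rw [← Finset.sum_add_distrib, ← Finset.sum_sub_distrib, Finset.sum_div]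
    refine Finset.sum_congr rfl fun ω _ => ?_
    ring
  linarith

lemma sum_pi_prod {α : Type*} [Fintype α] (n : ℕ) (f : Fin n → α → ℝ) :
    ∑ x : Fin n → α, ∏ i, f i (x i) = ∏ i, ∑ a, f i a := by
  rw [Finset.prod_univ_sum, Fintype.piFinset_univ]

lemma sum_prod_mul_coord {α : Type*} [Fintype α] (q : α → ℝ) (hq1 : ∑ a, q a = 1) (n : ℕ)
    (h : α → ℝ) (i : Fin n) :
    ∑ x : Fin n → α, (∏ j, q (x j)) * h (x i) = ∑ a, q a * h a := by
  have := sum_pi_prod n (fun j a => q a * if j = i then h a else 1)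
  simp only [Finset.prod_mul_distrib, Finset.prod_ite_eq', Finset.mem_univ, if_true] at this
  rw [this, Finset.prod_eq_single i]
  · simp
  · intro j _ hj
    simp [hj, hq1]
  · simp

lemma sum_prod_log {α : Type*} [Fintype α] (q : α → ℝ) (hq1 : ∑ a, q a = 1) (n : ℕ)
    (g : α → ℝ) (hg : ∀ a, q a ≠ 0 → g a ≠ 0) :
    ∑ x : Fin n → α, (∏ j, q (x j)) * Real.logb 2 (∏ j, g (x j))
      = n * ∑ a, q a * Real.logb 2 (g a) := by
  have : ∀ x : Fin n → α, (∏ j, q (x j)) * Real.logb 2 (∏ j, g (x j)) =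
      ∑ i, (∏ j, q (x j)) * Real.logb 2 (g (x i)) := by
    intro x
    by_cases h0 : ∏ j, q (x j) = 0
    · simp [h0]
    · rw [Real.logb_prod, Finset.mul_sum]
      intro i hi
      exact hg _ (Finset.prod_ne_zero_iff.mp h0 i hi)
  simp only [this]
  rw [Finset.sum_comm]
  simp [sum_prod_mul_coord q hq1 n (fun a => Real.logb 2 (g a))]

lemma encrypt_inj (m : ℕ) (b : List Bool) (hb : m ≤ b.length) (k k' : Fin m → Bool)
    (h : encrypt m b k = encrypt m b k') : k = k' := by
  funext i
  unfold encrypt at h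
  have := (List.map_inj_left.mp h) i (List.mem_range.mpr (i.2.trans_le hb))
  simpa using this

/-- **Direct-part equivocation bound.** Let `(X_t, W_t)` be i.i.d. pairs with joint pmf
`q` on finite alphabets (realized canonically on `(Fin n → 𝒳 × 𝒲) × (Fin m → Bool)`),
let `B = φ(X^n)` be a binary string which is a deterministic function of `X^n` of length
at least `m`, let `K` be uniform on `{0,1}^m` independent of `(X^n, W^n)`, and let `Z` be
obtained from `B` by XORing its first `m` bits with `K`. Then
`H(X^n | W^n, Z) ≥ n·H(X|W) − H(Z) + H(K)`, where `H(K) = m`. -/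
theorem equivocation_ge_of_one_time_pad
    {𝒳 𝒲 : Type*} [Fintype 𝒳] [Fintype 𝒲]
    (q : 𝒳 × 𝒲 → ℝ) (hq : ∀ a, 0 ≤ q a) (hq1 : ∑ a : 𝒳 × 𝒲, q a = 1)
    (n m : ℕ) (φ : (Fin n → 𝒳) → List Bool)
    (hlen : ∀ xs, m ≤ (φ xs).length)
    (p : ((Fin n → 𝒳 × 𝒲) × (Fin m → Bool)) → ℝ)
    (hp : p = fun ω => (∏ i, q (ω.1 i)) * (1 / 2) ^ m) :
    condEnt p (fun ω => fun i => (ω.1 i).1)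
        (fun ω => ((fun i => (ω.1 i).2), encrypt m (φ (fun i => (ω.1 i).1)) ω.2))
      ≥ (n : ℝ) * condEnt q Prod.fst Prod.snd
        - ent p (fun ω => encrypt m (φ (fun i => (ω.1 i).1)) ω.2) + m := by
  have hp0 : ∀ ω, 0 ≤ p ω := by
    intro ω
    rw [hp]
    exact mul_nonneg (Finset.prod_nonneg fun i _ => hq _) (by positivity)
  have hK : ∑ _k : Fin m → Bool, ((1 : ℝ) / 2) ^ m = 1 := by
    simp
  have hP1 : ∑ x : Fin n → 𝒳 × 𝒲, ∏ i, q (x i) = 1 := by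
    rw [sum_pi_prod n (fun _ => q)]
    simp [hq1]
  have hp1 : ∑ ω, p ω = 1 := by
    rw [hp, Fintype.sum_prod_type]
    simp only [← Finset.mul_sum, hK, mul_one, hP1]
  have hsub := ent_subadd p hp0 hp1 (fun ω => (fun i => (ω.1 i).2))
    (fun ω => encrypt m (φ (fun i => (ω.1 i).1)) ω.2)
  -- joint entropy
  have hjoint : ent p (fun ω => ((fun i => (ω.1 i).1),
      ((fun i => (ω.1 i).2), encrypt m (φ (fun i => (ω.1 i).1)) ω.2))) =
      n * ent q (fun a => (a.1, a.2)) + m := by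
    rw [ent_injective, ent_injective q _ (fun a b h => h)]
    · have hlog : ∀ ω, -(p ω * Real.logb 2 (p ω)) =
          -((∏ i, q (ω.1 i)) * Real.logb 2 (∏ i, q (ω.1 i))) * (1 / 2) ^ m
            + m * p ω := by
        intro ω
        by_cases h0 : ∏ i, q (ω.1 i) = 0
        · simp [hp, h0]
        · have hl : Real.logb 2 (((1 : ℝ) / 2) ^ m) = -m := by
            rw [Real.logb_pow, one_div, Real.logb_inv, Real.logb_self_eq_one (by norm_num)]
            ring
          simp only [hp]
          rw [Real.logb_mul h0 (by positivity), hl]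
          ring
      simp only [hlog]
      rw [Finset.sum_add_distrib, ← Finset.mul_sum, hp1, mul_one, Fintype.sum_prod_type]
      simp only [← Finset.mul_sum, hK, mul_one]
      rw [Finset.sum_neg_distrib, sum_prod_log q hq1 n q (fun _ h => h), Finset.sum_neg_distrib]
      ring
    · rintro ⟨x, k⟩ ⟨x', k'⟩ h
      simp only [Prod.mk.injEq] at h
      obtain ⟨h1, h2, h3⟩ := h
      have hx : x = x' := by
        funext i
        exact Prod.ext (congrFun h1 i) (congrFun h2 i)
      subst hx
      rw [encrypt_inj m _ (hlen _) _ _ h3]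
  have hW : ent p (fun ω => (fun i => (ω.1 i).2)) = n * ent q Prod.snd := by
    have hpr : ∀ ω : (Fin n → 𝒳 × 𝒲) × (Fin m → Bool),
        pr p (fun ω' => (fun i => (ω'.1 i).2) = (fun i => (ω.1 i).2)) =
        ∏ i, pr q (fun a => a.2 = (ω.1 i).2) := by
      intro ω
      unfold pr
      rw [← sum_pi_prod n (fun i a => if a.2 = (ω.1 i).2 then q a else 0),
        Fintype.sum_prod_type]
      refine Finset.sum_congr rfl fun x _ => ?_
      by_cases h : (fun i => (x i).2) = (fun i => (ω.1 i).2)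
      · have h' : ∀ i, (x i).2 = (ω.1 i).2 := fun i => congrFun h i
        simp only [h, if_true, h', hp, ← Finset.mul_sum, hK, mul_one]
      · simp only [h, if_false, Finset.sum_const_zero]
        obtain ⟨i, hi⟩ := Function.ne_iff.mp h
        rw [Finset.prod_eq_zero (Finset.mem_univ i)]
        simp only [hi, if_false]
    unfold ent
    simp only [hpr]
    have hre : ∀ ω, -(p ω * Real.logb 2 (∏ i, pr q (fun a => a.2 = (ω.1 i).2))) =
        -((∏ i, q (ω.1 i)) * Real.logb 2 (∏ i, pr q (fun a => a.2 = (ω.1 i).2))) *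
          (1 / 2) ^ m := by
      intro ω
      simp only [hp]
      ring
    simp only [hre]
    rw [Fintype.sum_prod_type]
    simp only [← Finset.mul_sum, hK, mul_one]
    rw [Finset.sum_neg_distrib, sum_prod_log q hq1 n (fun b => pr q (fun a => a.2 = b.2)),
      Finset.sum_neg_distrib]
    · ring
    · intro a ha
      exact (((hq a).lt_of_ne' ha).trans_le (le_pr_self q hq (fun a' => a'.2 = a.2) a rfl)).ne'
  unfold condEnt
  rw [hjoint]
  rw [hW] at hsub
  linarith
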